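/- For all f, g : S → ℤ/2ℤ, every i ∈ ℕ and every x ∈ S: h⁽²⁾ᵢ(x) equals the sum, over all pairs (y, z) with y ⪯ x, z ⪯ x, and y_q ⋈ z_q = D for every position q with x_q = D, of [ |{q : x_q ∈ classC and y_q ∈ classC}| + |{q : x_q ∈ classC and z_q ∈ classC}| = i ] · f(y) · g(z). -/

import Mathlib

/-- The six states `𝟎, D, D*, C, C⁺, C*`. -/
inductive S0 : Type
  | O | D | Ds | C | Cp | Cs
  deriving DecidableEq

instance : Fintype S0 :=
  ⟨{S0.O, S0.D, S0.Ds, S0.C, S0.Cp, S0.Cs}, by intro x; cases x <;> decide⟩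

/-- The order `≤` on states, generated by `𝟎 < D < D* < C⁺ < C*` and `𝟎 < C < C⁺`. -/
def le0 : S0 → S0 → Bool
  | .O, _ => true
  | .D, .D => true | .D, .Ds => true | .D, .Cp => true | .D, .Cs => true
  | .Ds, .Ds => true | .Ds, .Cp => true | .Ds, .Cs => true
  | .C, .C => true | .C, .Cp => true | .C, .Cs => true
  | .Cp, .Cp => true | .Cp, .Cs => true
  | .Cs, .Cs => true
  | _, _ => false

/-- The order `≤₁`: `a ≤₁ b` iff `a = b` or `b = C*`. -/
def le1 : S0 → S0 → Bool := fun a b => a == b || b == .Cs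

/-- The order `≤₂`: `a ≤₂ b` iff `a = b`, or `b = C⁺` and `a ∈ {𝟎, D, D*, C}`, or `b = D*`
and `a ∈ {𝟎, D}`, or `b = C` and `a = 𝟎`. -/
def le2 : S0 → S0 → Bool := fun a b =>
  a == b || (b == .Cp && (a == .O || a == .D || a == .Ds || a == .C)) ||
    (b == .Ds && (a == .O || a == .D)) || (b == .C && a == .O)

/-- The order `≤₃`: `a ≤₃ b` iff `a = b`, or `a = 𝟎` and `b = D`. -/
def le3 : S0 → S0 → Bool := fun a b => a == b || (a == .O && b == .D)

/-- The commutative join operation `⋈` on states. -/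
def jn : S0 → S0 → S0
  | .O, a => a
  | a, .O => a
  | .Cs, _ => .Cs
  | _, .Cs => .Cs
  | .D, .D => .Ds | .D, .Ds => .Ds | .Ds, .D => .Ds | .Ds, .Ds => .Ds
  | .D, .C => .Cp | .D, .Cp => .Cp | .Ds, .C => .Cp | .Ds, .Cp => .Cp
  | .C, .D => .Cp | .Cp, .D => .Cp | .C, .Ds => .Cp | .Cp, .Ds => .Cp
  | .C, .C => .Cs | .C, .Cp => .Cs | .Cp, .C => .Cs | .Cp, .Cp => .Cs

/-- The zeta matrix of the componentwise order induced by a base relation `r` on `S0`: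
its `(x, y)` entry is `1` if `y ⊑ x` and `0` otherwise. -/
def zMat (k : ℕ) (r : S0 → S0 → Bool) : Matrix (Fin k → S0) (Fin k → S0) (ZMod 2) :=
  Matrix.of fun x y => if ∀ q, r (y q) (x q) = true then 1 else 0

/-- The zeta transform `ζf(x) = Σ_{y ⊑ x} f(y)` of the componentwise order of `r`. -/
def zetaT (k : ℕ) (r : S0 → S0 → Bool) (f : (Fin k → S0) → ZMod 2) :
    (Fin k → S0) → ZMod 2 :=
  (zMat k r).mulVec f

/-- The Möbius transform of the componentwise order of `r`: the inverse of the zeta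
transform. -/
noncomputable def muT (k : ℕ) (r : S0 → S0 → Bool) (f : (Fin k → S0) → ZMod 2) :
    (Fin k → S0) → ZMod 2 :=
  (zMat k r)⁻¹.mulVec f

/-- The number of coordinates of `x` whose state is in `classC = {C, C⁺}`. -/
def cardC (k : ℕ) (x : Fin k → S0) : ℕ :=
  (Finset.univ.filter fun q => x q = S0.C ∨ x q = S0.Cp).card

/-- The number of coordinates of `x` whose state is in `classD = {D}`. -/
def cardD (k : ℕ) (x : Fin k → S0) : ℕ :=
  (Finset.univ.filter fun q => x q = S0.D).card

/-- The number of coordinates where both `x` and `y` have a state in `classC`. -/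
def cardCC (k : ℕ) (x y : Fin k → S0) : ℕ :=
  (Finset.univ.filter fun q => (x q = S0.C ∨ x q = S0.Cp) ∧ (y q = S0.C ∨ y q = S0.Cp)).card

/-- The number of coordinates where both `x` and `y` have state `D`. -/
def cardDD (k : ℕ) (x y : Fin k → S0) : ℕ :=
  (Finset.univ.filter fun q => x q = S0.D ∧ y q = S0.D).card

/-- The filter `f|ᵢ^{classC}`. -/
def restrC (k : ℕ) (i : ℕ) (f : (Fin k → S0) → ZMod 2) : (Fin k → S0) → ZMod 2 :=
  fun x => if cardC k x = i then f x else 0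

/-- The filter `f|ⱼ^{classD}`. -/
def restrD (k : ℕ) (j : ℕ) (f : (Fin k → S0) → ZMod 2) : (Fin k → S0) → ZMod 2 :=
  fun x => if cardD k x = j then f x else 0

/-- `f⁽³⁾_{i,j} = ζ₃ ((ζ₂ ((ζ₁ f)|ᵢ^{classC}))|ⱼ^{classD})`. -/
def F3 (k : ℕ) (f : (Fin k → S0) → ZMod 2) (i j : ℕ) : (Fin k → S0) → ZMod 2 :=
  zetaT k le3 (restrD k j (zetaT k le2 (restrC k i (zetaT k le1 f))))

/-- `h⁽³⁾_{i,j} = Σ_{i₁+i₂=i, j₁+j₂=j} f⁽³⁾_{i₁,j₁} · g⁽³⁾_{i₂,j₂}` (pointwise product). -/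
def H3 (k : ℕ) (f g : (Fin k → S0) → ZMod 2) (i j : ℕ) : (Fin k → S0) → ZMod 2 :=
  fun x => ∑ a ∈ Finset.HasAntidiagonal.antidiagonal i, ∑ b ∈ Finset.HasAntidiagonal.antidiagonal j,
    F3 k f a.1 b.1 x * F3 k g a.2 b.2 x

/-- `h⁽²⁾_{i,j} = μ₃ h⁽³⁾_{i,j}`. -/
noncomputable def H2 (k : ℕ) (f g : (Fin k → S0) → ZMod 2) (i j : ℕ) :
    (Fin k → S0) → ZMod 2 :=
  muT k le3 (H3 k f g i j)

/-- `h⁽²⁾ᵢ(x) = h⁽²⁾_{i,j}(x)` for `j = |{q : x_q = D}|`. -/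
noncomputable def H2i (k : ℕ) (f g : (Fin k → S0) → ZMod 2) (i : ℕ) :
    (Fin k → S0) → ZMod 2 :=
  fun x => H2 k f g i (cardD k x) x

/-- `h⁽¹⁾ᵢ = μ₂ h⁽²⁾ᵢ`. -/
noncomputable def H1i (k : ℕ) (f g : (Fin k → S0) → ZMod 2) (i : ℕ) :
    (Fin k → S0) → ZMod 2 :=
  muT k le2 (H2i k f g i)

/-- `h⁽¹⁾(x) = h⁽¹⁾ᵢ(x)` for `i = |{q : x_q ∈ classC}|`. -/
noncomputable def H1 (k : ℕ) (f g : (Fin k → S0) → ZMod 2) : (Fin k → S0) → ZMod 2 :=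
  fun x => H1i k f g (cardC k x) x

theorem zetaT_apply (k : ℕ) (r : S0 → S0 → Bool) (f : (Fin k → S0) → ZMod 2)
    (x : Fin k → S0) :
    zetaT k r f x = ∑ y, if ∀ q, r (y q) (x q) = true then f y else 0 := by
  simp [zetaT, zMat, Matrix.mulVec, dotProduct]

/-- For `u ≤ x`, the only state `w ≤₃ x` with `u ≤ w` that is `D` exactly when `x = u = D`. -/
def shrinkD (x u : S0) : S0 := if x = .D then u else x

/-- The only state `v` with `u ≤₁ v ≤₂ shrinkD x u`, for `u ≤ x`. -/
def raiseCs (x u : S0) : S0 := if x = .Cs then .Cs else u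

theorem le3_le2_le1_iff (x w v u : S0) :
    (le3 w x = true ∧ le2 v w = true ∧ le1 u v = true) ↔
      (le0 u x = true ∧ w = shrinkD x u ∧ v = raiseCs x u) := by
  revert x w v u; decide

theorem raiseCs_mem_classC_iff {x u : S0} (h : le0 u x = true) :
    (raiseCs x u = .C ∨ raiseCs x u = .Cp) ↔ ((x = .C ∨ x = .Cp) ∧ (u = .C ∨ u = .Cp)) := by
  revert x u; decide

theorem shrinkD_eq_D_iff (x u : S0) : shrinkD x u = .D ↔ (x = .D ∧ u = .D) := by
  revert x u; decide

theorem forall_le3_le2_le1_iff {k : ℕ} (x w v u : Fin k → S0) :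
    ((∀ q, le3 (w q) (x q) = true) ∧ (∀ q, le2 (v q) (w q) = true) ∧
        (∀ q, le1 (u q) (v q) = true)) ↔
      ((∀ q, le0 (u q) (x q) = true) ∧ w = (fun q => shrinkD (x q) (u q)) ∧
        v = fun q => raiseCs (x q) (u q)) := by
  simp only [funext_iff, ← forall_and, le3_le2_le1_iff]

theorem F3_apply (k : ℕ) (f : (Fin k → S0) → ZMod 2) (i j : ℕ) (x : Fin k → S0) :
    F3 k f i j x = ∑ u, if (∀ q, le0 (u q) (x q) = true) ∧ cardCC k x u = i ∧
      cardDD k x u = j then f u else 0 := by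
  have expand : F3 k f i j x = ∑ w, ∑ v, ∑ u,
      if ((∀ q, le3 (w q) (x q) = true) ∧ (∀ q, le2 (v q) (w q) = true) ∧
        (∀ q, le1 (u q) (v q) = true)) ∧ cardC k v = i ∧ cardD k w = j then f u else 0 := by
    simp only [F3, zetaT_apply, restrD, restrC]
    refine Finset.sum_congr rfl fun w _ => ?_
    by_cases hw : ∀ q, le3 (w q) (x q) = true <;> by_cases hj : cardD k w = j <;>
      simp only [hw, hj, if_true, if_false, true_and, false_and, and_false, and_true,
        Finset.sum_const_zero, implies_true]
    refine Finset.sum_congr rfl fun v _ => ?_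
    by_cases hv : ∀ q, le2 (v q) (w q) = true <;> by_cases hi : cardC k v = i <;>
      simp [hv, hi]
  rw [expand]
  simp only [forall_le3_le2_le1_iff]
  rw [Finset.sum_congr rfl fun w _ => Finset.sum_comm, Finset.sum_comm]
  refine Finset.sum_congr rfl fun u _ => ?_
  rw [Finset.sum_eq_single (fun q => shrinkD (x q) (u q)),
    Finset.sum_eq_single (fun q => raiseCs (x q) (u q))]
  · by_cases hu : ∀ q, le0 (u q) (x q) = true
    · simp [hu, cardC, cardD, cardCC, cardDD, raiseCs_mem_classC_iff, shrinkD_eq_D_iff]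
    · simp [hu]
  · intro v _ hv
    simp [hv]
  · simp
  · intro w _ hw
    simp [hw]
  · simp

theorem sum_antidiagonal_ite_mul_ite {R : Type*} [NonUnitalNonAssocSemiring R]
    (i j c d c' d' : ℕ) (a b : R) :
    (∑ p ∈ Finset.HasAntidiagonal.antidiagonal i, ∑ q ∈ Finset.HasAntidiagonal.antidiagonal j,
      (if c = p.1 ∧ d = q.1 then a else 0) * (if c' = p.2 ∧ d' = q.2 then b else 0)) =
      if c + c' = i ∧ d + d' = j then a * b else 0 := by
  have key : ∀ p q : ℕ × ℕ,
      (if c = p.1 ∧ d = q.1 then a else 0) * (if c' = p.2 ∧ d' = q.2 then b else 0) =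
        if (c, c') = p then if (d, d') = q then a * b else 0 else 0 := by
    rintro ⟨p, p'⟩ ⟨q, q'⟩
    simp only [Prod.mk.injEq]
    split_ifs <;> simp_all
  simp only [key]
  simp [Finset.sum_ite_irrel, ite_and]

theorem H3_apply (k : ℕ) (f g : (Fin k → S0) → ZMod 2) (i j : ℕ) (x : Fin k → S0) :
    H3 k f g i j x = ∑ y, ∑ z,
      if ((∀ q, le0 (y q) (x q) = true) ∧ (∀ q, le0 (z q) (x q) = true)) ∧
        cardCC k x y + cardCC k x z = i ∧ cardDD k x y + cardDD k x z = j
      then f y * g z else 0 := by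
  simp only [H3, F3_apply, Finset.sum_mul_sum]
  rw [Finset.sum_congr rfl fun a _ => Finset.sum_comm, Finset.sum_comm]
  refine Finset.sum_congr rfl fun y _ => ?_
  rw [Finset.sum_congr rfl fun a _ => Finset.sum_comm, Finset.sum_comm]
  refine Finset.sum_congr rfl fun z _ => ?_
  by_cases hy : ∀ q, le0 (y q) (x q) = true <;> by_cases hz : ∀ q, le0 (z q) (x q) = true
  · simpa [hy, hz] using sum_antidiagonal_ite_mul_ite i j (cardCC k x y) (cardDD k x y)
      (cardCC k x z) (cardDD k x z) (f y) (g z)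
  all_goals simp [hy, hz]

theorem zMat_apply_eq_prod (k : ℕ) (r : S0 → S0 → Bool) (x y : Fin k → S0) :
    zMat k r x y = ∏ q, if r (y q) (x q) = true then 1 else 0 := by
  simp [zMat, Finset.prod_ite_zero]

/-- Intervals of `≤₃` have one or two elements, so modulo `2` its zeta matrix is an involution. -/
theorem zMat_le3_mul_self (k : ℕ) : zMat k le3 * zMat k le3 = 1 := by
  ext x y
  have base : ∀ a b : S0, (∑ c, (if le3 c a = true then (1 : ZMod 2) else 0) *
      (if le3 b c = true then 1 else 0)) = if a = b then 1 else 0 := by decide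
  simp only [Matrix.mul_apply, zMat_apply_eq_prod, ← Finset.prod_mul_distrib]
  rw [← Fintype.prod_sum (fun q c => (if le3 c (x q) = true then (1 : ZMod 2) else 0) *
      (if le3 (y q) c = true then 1 else 0))]
  simp only [base]
  simp [Finset.prod_ite_zero, Matrix.one_apply, funext_iff]

theorem muT_le3_zetaT_le3 (k : ℕ) (f : (Fin k → S0) → ZMod 2) :
    muT k le3 (zetaT k le3 f) = f := by
  rw [muT, zetaT, Matrix.inv_eq_left_inv (zMat_le3_mul_self k), Matrix.mulVec_mulVec,
    zMat_le3_mul_self, Matrix.one_mulVec]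

/-- For `y, z ≤ x`, the only state `w ≤₃ x` above `y` and `z` that is not `D` unless `y` or `z` is. -/
def shrinkPair (x y z : S0) : S0 := if x = .D ∧ y = .O ∧ z = .O then .O else x

theorem le3_le0_iff (x w y z : S0) :
    (le3 w x = true ∧ le0 y w = true ∧ le0 z w = true ∧ (w = .D → y = .D ∨ z = .D)) ↔
      (le0 y x = true ∧ le0 z x = true ∧ w = shrinkPair x y z) := by
  revert x w y z; decide

theorem shrinkPair_classC_iff (x y z : S0) :
    (shrinkPair x y z = .C ∨ shrinkPair x y z = .Cp) ↔ (x = .C ∨ x = .Cp) := by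
  revert x y z; decide

theorem shrinkPair_eq_D_and_iff (x y z : S0) :
    (shrinkPair x y z = .D ∧ y = .D ↔ x = .D ∧ y = .D) ∧
      (shrinkPair x y z = .D ∧ z = .D ↔ x = .D ∧ z = .D) := by
  revert x y z; decide

/-- The closed form of `h⁽²⁾_{i,j}`. -/
def pairSum (k : ℕ) (f g : (Fin k → S0) → ZMod 2) (i j : ℕ) (x : Fin k → S0) : ZMod 2 :=
  ∑ y, ∑ z,
    if (∀ q, le0 (y q) (x q) = true ∧ le0 (z q) (x q) = true ∧
        (x q = .D → y q = .D ∨ z q = .D)) ∧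
      cardCC k x y + cardCC k x z = i ∧ cardDD k x y + cardDD k x z = j
    then f y * g z else 0

theorem zetaT_le3_pairSum (k : ℕ) (f g : (Fin k → S0) → ZMod 2) (i j : ℕ) :
    zetaT k le3 (pairSum k f g i j) = H3 k f g i j := by
  funext x
  have expand : zetaT k le3 (pairSum k f g i j) x = ∑ w, ∑ y, ∑ z,
      if (∀ q, le3 (w q) (x q) = true ∧ le0 (y q) (w q) = true ∧ le0 (z q) (w q) = true ∧
          (w q = .D → y q = .D ∨ z q = .D)) ∧
        cardCC k w y + cardCC k w z = i ∧ cardDD k w y + cardDD k w z = j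
      then f y * g z else 0 := by
    rw [zetaT_apply]
    refine Finset.sum_congr rfl fun w _ => ?_
    by_cases hw : ∀ q, le3 (w q) (x q) = true
    · simp [hw, pairSum]
    · simp [hw, forall_and]
  rw [expand, H3_apply, Finset.sum_comm]
  refine Finset.sum_congr rfl fun y _ => ?_
  rw [Finset.sum_comm]
  refine Finset.sum_congr rfl fun z _ => ?_
  simp only [le3_le0_iff, forall_and]
  rw [Finset.sum_eq_single (fun q => shrinkPair (x q) (y q) (z q))]
  · refine if_congr ?_ rfl rfl
    simp [cardCC, cardDD, shrinkPair_classC_iff, shrinkPair_eq_D_and_iff]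
  · intro w _ hw
    have : ¬ ∀ q, w q = shrinkPair (x q) (y q) (z q) := fun h => hw (funext h)
    simp [this]
  · simp

/-- If `y` and `z` cover the `D`-positions of `x`, then the numbers of `D`s they have there add
up to the number of these positions exactly when `y` and `z` are nowhere both `D`. -/
theorem cardDD_add_eq_cardD_iff {k : ℕ} (x y z : Fin k → S0)
    (h : ∀ q, x q = .D → y q = .D ∨ z q = .D) :
    cardDD k x y + cardDD k x z = cardD k x ↔ ∀ q, x q = .D → ¬ (y q = .D ∧ z q = .D) := by
  have union : (Finset.univ.filter fun q => x q = S0.D ∧ y q = S0.D) ∪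
      (Finset.univ.filter fun q => x q = S0.D ∧ z q = S0.D) =
      Finset.univ.filter fun q => x q = S0.D := by
    ext q
    have := h q
    simp only [Finset.mem_union, Finset.mem_filter, Finset.mem_univ, true_and]
    tauto
  have hcard := Finset.card_union_add_card_inter
    (Finset.univ.filter fun q => x q = S0.D ∧ y q = S0.D)
    (Finset.univ.filter fun q => x q = S0.D ∧ z q = S0.D)
  rw [union] at hcard
  rw [cardDD, cardDD, cardD, ← hcard, Nat.add_eq_left, Finset.card_eq_zero,
    Finset.eq_empty_iff_forall_notMem]
  simp only [Finset.mem_inter, Finset.mem_filter, Finset.mem_univ, true_and]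
  exact forall_congr' fun q => by tauto

theorem jn_eq_D_iff (y z : S0) (hy : le0 y .D = true) (hz : le0 z .D = true) :
    jn y z = .D ↔ (y = .D ∨ z = .D) ∧ ¬ (y = .D ∧ z = .D) := by
  revert y z; decide

/-- `h⁽²⁾ᵢ(x)` equals the sum over all pairs `(y, z)` with `y ⪯ x`,
`z ⪯ x` and `y_q ⋈ z_q = D` at every position `q` with `x_q = D`, of
`[|C_{y on x}| + |C_{z on x}| = i] · f(y) · g(z)`. -/
theorem H2i_eq_sum (k : ℕ) (f g : (Fin k → S0) → ZMod 2) (i : ℕ) (x : Fin k → S0) :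
    H2i k f g i x =
      ∑ y : Fin k → S0, ∑ z : Fin k → S0,
        if (∀ q, le0 (y q) (x q) = true) ∧ (∀ q, le0 (z q) (x q) = true) ∧
            (∀ q, x q = S0.D → jn (y q) (z q) = S0.D) ∧
            cardCC k x y + cardCC k x z = i then
          f y * g z
        else 0 := by
  have hmu : H2i k f g i x = pairSum k f g i (cardD k x) x := by
    rw [H2i, H2, ← zetaT_le3_pairSum, muT_le3_zetaT_le3]
  rw [hmu, pairSum]
  refine Finset.sum_congr rfl fun y _ => Finset.sum_congr rfl fun z _ => if_congr ?_ rfl rfl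
  simp only [forall_and]
  have join (hy : ∀ q, le0 (y q) (x q) = true) (hz : ∀ q, le0 (z q) (x q) = true) :
      (∀ q, x q = S0.D → jn (y q) (z q) = S0.D) ↔
        (∀ q, x q = S0.D → y q = S0.D ∨ z q = S0.D) ∧
          ∀ q, x q = S0.D → ¬ (y q = S0.D ∧ z q = S0.D) := by
    rw [← forall_and]
    refine forall_congr' fun q => ?_
    rw [← imp_and]
    exact imp_congr_right fun hq => jn_eq_D_iff _ _ (hq ▸ hy q) (hq ▸ hz q)
  constructor
  · rintro ⟨⟨hy, hz, hD⟩, hC, hj⟩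
    exact ⟨hy, hz, (join hy hz).2 ⟨hD, (cardDD_add_eq_cardD_iff x y z hD).1 hj⟩, hC⟩
  · rintro ⟨hy, hz, hjn, hC⟩
    obtain ⟨hD, hn⟩ := (join hy hz).1 hjn
    exact ⟨⟨hy, hz, hD⟩, hC, (cardDD_add_eq_cardD_iff x y z hD).2 hn⟩
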